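/- arXiv:2506.19311 — 3 statements merged into one kernel-verified Lean document; each statement's English description precedes it below -/
import Mathlib

section
/- Let n ≥ 1 be an integer and let f : ℝⁿ → ℝ be a compactly supported function that is Hölder continuous with some exponent β ∈ (0,1]. Then for every x ∈ ℝⁿ the integral ∫₀^∞ (e^{-t} f(x) − (4πt)^{-n/2} ∫_{ℝⁿ} e^{-|x−y|²/(4t)} f(y) dy)/t dt converges and equals c_n ∫_{B₁(x)} (f(x) − f(y))/|x−y|ⁿ dy − c_n ∫_{ℝⁿ∖B₁(x)} f(y)/|x−y|ⁿ dy + ρ_n f(x), where c_n = π^{-n/2} Γ(n/2) and ρ_n = 2 log 2 + Γ'(n/2)/Γ(n/2) − γ. -/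
open MeasureTheory Real

lemma LL_step (a : ℝ) (ha : 0 < a) :
    IntegrableOn (fun t : ℝ => ((if t < a then (1:ℝ) else 0) - (if t < 1 then (1:ℝ) else 0)) / t)
      (Set.Ioi 0) ∧
    (∫ t in Set.Ioi (0:ℝ), ((if t < a then (1:ℝ) else 0) - (if t < 1 then (1:ℝ) else 0)) / t)
      = Real.log a ∧
    (∫ t in Set.Ioi (0:ℝ), ‖((if t < a then (1:ℝ) else 0) - (if t < 1 then (1:ℝ) else 0)) / t‖)
      = |Real.log a| := by
  have base : ∀ p q : ℝ, 0 < p → p ≤ q →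
      IntegrableOn (fun t : ℝ => t⁻¹) (Set.Ioc p q) ∧
      ∫ t in Set.Ioc p q, t⁻¹ = Real.log q - Real.log p := by
    intro p q hp hpq
    constructor
    · have : IntervalIntegrable (fun t : ℝ => t⁻¹) volume p q := by
        apply intervalIntegral.intervalIntegrable_inv
        · intro x hx
          rw [Set.uIcc_of_le hpq] at hx
          linarith [hx.1]
        · exact continuousOn_id
      exact (intervalIntegrable_iff_integrableOn_Ioc_of_le hpq).1 this
    · rw [← intervalIntegral.integral_of_le hpq, integral_inv_of_pos hp (by linarith),
        Real.log_div (by linarith) (by linarith)]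
  rcases le_total 1 a with h | h
  · obtain ⟨b1, b2⟩ := base 1 a one_pos h
    have e : (fun t : ℝ => ((if t < a then (1:ℝ) else 0) - (if t < 1 then (1:ℝ) else 0)) / t)
        = Set.indicator (Set.Ico 1 a) (fun t => t⁻¹) := by
      ext t
      simp only [Set.indicator, Set.mem_Ico]
      by_cases h1 : t < 1
      · have : t < a := by linarith
        simp [h1, this, not_le.2 h1]
      · by_cases h2 : t < a <;> simp [h1, h2, not_lt.1 h1]
    have e' : (fun t : ℝ => ‖((if t < a then (1:ℝ) else 0) - (if t < 1 then (1:ℝ) else 0)) / t‖)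
        = Set.indicator (Set.Ico 1 a) (fun t => t⁻¹) := by
      ext t
      rw [show ((if t < a then (1:ℝ) else 0) - (if t < 1 then (1:ℝ) else 0)) / t = _ from
        congrFun e t]
      simp only [Set.indicator, Set.mem_Ico]
      split_ifs with h1
      · simp; linarith
      · simp
    have sub : Set.Ico 1 a ∩ Set.Ioi 0 = Set.Ico 1 a := by
      ext t; simp; intro h _; linarith
    have val : ∫ t in Set.Ioi (0:ℝ), Set.indicator (Set.Ico 1 a) (fun t => t⁻¹) t = Real.log a := by
      rw [integral_indicator measurableSet_Ico, Measure.restrict_restrict measurableSet_Ico, sub,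
        integral_Ico_eq_integral_Ioc, b2]
      simp
    refine ⟨?_, ?_, ?_⟩
    · rw [e, IntegrableOn, integrable_indicator_iff measurableSet_Ico, IntegrableOn,
        Measure.restrict_restrict measurableSet_Ico, sub]
      exact (integrableOn_Ico_iff_integrableOn_Ioo (by simp)).2 (b1.mono_set Set.Ioo_subset_Ioc_self)
    · rw [e, val]
    · rw [e', val, abs_of_nonneg (Real.log_nonneg h)]
  · obtain ⟨b1, b2⟩ := base a 1 ha h
    have e : (fun t : ℝ => ((if t < a then (1:ℝ) else 0) - (if t < 1 then (1:ℝ) else 0)) / t)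
        = fun t => - Set.indicator (Set.Ico a 1) (fun t => t⁻¹) t := by
      ext t
      simp only [Set.indicator, Set.mem_Ico]
      by_cases h1 : t < a
      · have : t < 1 := by linarith
        simp [h1, this, not_le.2 h1]
      · by_cases h2 : t < 1 <;> simp [h1, h2, not_lt.1 h1, div_eq_mul_inv]
    have e' : (fun t : ℝ => ‖((if t < a then (1:ℝ) else 0) - (if t < 1 then (1:ℝ) else 0)) / t‖)
        = Set.indicator (Set.Ico a 1) (fun t => t⁻¹) := by
      ext t
      rw [show ((if t < a then (1:ℝ) else 0) - (if t < 1 then (1:ℝ) else 0)) / t = _ from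
        congrFun e t]
      simp only [Set.indicator, Set.mem_Ico]
      split_ifs with h1
      · simp; linarith
      · simp
    have sub : Set.Ico a 1 ∩ Set.Ioi 0 = Set.Ico a 1 := by
      ext t; simp; intro h _; linarith
    have val : ∫ t in Set.Ioi (0:ℝ), Set.indicator (Set.Ico a 1) (fun t => t⁻¹) t
        = - Real.log a := by
      rw [integral_indicator measurableSet_Ico, Measure.restrict_restrict measurableSet_Ico, sub,
        integral_Ico_eq_integral_Ioc, b2]
      simp
    refine ⟨?_, ?_, ?_⟩
    · rw [e, IntegrableOn]
      apply Integrable.neg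
      rw [integrable_indicator_iff measurableSet_Ico, IntegrableOn,
        Measure.restrict_restrict measurableSet_Ico, sub]
      exact (integrableOn_Ico_iff_integrableOn_Ioo (by simp)).2 (b1.mono_set Set.Ioo_subset_Ioc_self)
    · rw [e, integral_neg, val, neg_neg]
    · rw [e', val, abs_of_nonpos (Real.log_nonpos ha.le h)]

lemma LL_key (w X : ℝ → ℝ) (hwm : Measurable w) (hw : IntegrableOn w (Set.Ioi 0))
    (hw1 : ∫ s in Set.Ioi (0:ℝ), w s = 1) (hX : Measurable X)
    (hXpos : ∀ s > 0, 0 < X s)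
    (hlog : IntegrableOn (fun s => w s * Real.log (X s)) (Set.Ioi 0)) :
    IntegrableOn (fun t : ℝ => ((∫ s in Set.Ioi (0:ℝ), w s * (if t < X s then (1:ℝ) else 0))
      - (if t < 1 then (1:ℝ) else 0)) / t) (Set.Ioi 0) ∧
    ∫ t in Set.Ioi (0:ℝ), ((∫ s in Set.Ioi (0:ℝ), w s * (if t < X s then (1:ℝ) else 0))
      - (if t < 1 then (1:ℝ) else 0)) / t = ∫ s in Set.Ioi (0:ℝ), w s * Real.log (X s) := by
  set F : ℝ → ℝ → ℝ := fun s t =>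
    w s * (((if t < X s then (1:ℝ) else 0) - (if t < 1 then (1:ℝ) else 0)) / t) with hF
  have hmeas : Measurable (Function.uncurry F) := by
    have h1 : MeasurableSet {p : ℝ × ℝ | p.2 < X p.1} :=
      measurableSet_lt measurable_snd (hX.comp measurable_fst)
    have h2 : MeasurableSet {p : ℝ × ℝ | p.2 < 1} :=
      measurableSet_lt measurable_snd measurable_const
    refine (hwm.comp measurable_fst).mul (Measurable.div (Measurable.sub ?_ ?_) measurable_snd)
    · exact Measurable.ite h1 measurable_const measurable_const
    · exact Measurable.ite h2 measurable_const measurable_const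
  have hint : Integrable (Function.uncurry F)
      ((volume.restrict (Set.Ioi (0:ℝ))).prod (volume.restrict (Set.Ioi (0:ℝ)))) := by
    rw [integrable_prod_iff hmeas.aestronglyMeasurable]
    constructor
    · filter_upwards [ae_restrict_mem measurableSet_Ioi] with s hs
      exact (LL_step (X s) (hXpos s hs)).1.const_mul (w s)
    · refine hlog.norm.congr ?_
      filter_upwards [ae_restrict_mem measurableSet_Ioi] with s hs
      simp only [Function.uncurry_apply_pair, hF, norm_mul]
      rw [integral_const_mul, (LL_step (X s) (hXpos s hs)).2.2, Real.norm_eq_abs (log _)]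
  have inner : ∀ t : ℝ, ∫ s in Set.Ioi (0:ℝ), F s t =
      ((∫ s in Set.Ioi (0:ℝ), w s * (if t < X s then (1:ℝ) else 0))
      - (if t < 1 then (1:ℝ) else 0)) / t := by
    intro t
    have i1 : IntegrableOn (fun s => w s * (if t < X s then (1:ℝ) else 0)) (Set.Ioi 0) := by
      refine Integrable.mono hw (hwm.mul (Measurable.ite (measurableSet_lt measurable_const hX)
        measurable_const measurable_const)).aestronglyMeasurable (Filter.Eventually.of_forall ?_)
      intro s
      by_cases h : t < X s <;> simp [h]
    have : ∀ s, F s t = (w s * (if t < X s then (1:ℝ) else 0) -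
        w s * (if t < 1 then (1:ℝ) else 0)) / t := by
      intro s; simp only [hF]; ring
    simp_rw [this]
    rw [integral_div, integral_sub i1 (hw.mul_const _), integral_mul_const, hw1, one_mul]
  have h1 := hint.integral_prod_right
  have h2 := integral_integral_swap hint
  simp only [Function.uncurry_apply_pair] at h1 
  simp_rw [inner] at h1 h2
  refine ⟨h1, h2.symm.trans ?_⟩
  refine setIntegral_congr_fun measurableSet_Ioi fun s hs => ?_
  simp only [hF]
  rw [integral_const_mul, (LL_step (X s) (hXpos s hs)).2.1]

lemma LL_gamma (a : ℝ) (ha : 0 < a) :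
    IntegrableOn (fun t : ℝ => t ^ (a - 1) * Real.exp (-t) * Real.log t) (Set.Ioi 0) ∧
    deriv Real.Gamma a = ∫ t in Set.Ioi (0:ℝ), t ^ (a - 1) * Real.exp (-t) * Real.log t := by
  have hre : 0 < (a : ℂ).re := by simpa
  have H := (mellin_hasDerivAt_of_isBigO_rpow (E := ℂ) (f := fun t : ℝ => (Real.exp (-t) : ℂ))
    (s := (a:ℂ)) (a := (a:ℂ).re + 1) (b := 0)
    ((Continuous.continuousOn (by fun_prop)).locallyIntegrableOn measurableSet_Ioi) (by
    rw [← Asymptotics.isBigO_norm_left]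
    simp_rw [Complex.norm_real, Asymptotics.isBigO_norm_left]
    simpa only [neg_one_mul] using (isLittleO_exp_neg_mul_rpow_atTop zero_lt_one _).isBigO)
     (lt_add_one _) (by
    simp_rw [neg_zero, rpow_zero]
    refine Asymptotics.isBigO_const_of_tendsto (?_ : Filter.Tendsto _ _ (nhds (1 : ℂ))) one_ne_zero
    rw [(by simp : (1 : ℂ) = Real.exp (-0))]
    exact (Complex.continuous_ofReal.comp (Real.continuous_exp.comp continuous_neg)).continuousWithinAt) hre).1
  have D := Complex.hasDerivAt_GammaIntegral hre
  have eqn : ∀ t ∈ Set.Ioi (0:ℝ), (t:ℂ) ^ ((a:ℂ) - 1) * (Real.log t * Real.exp (-t)) =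
      ((t ^ (a - 1) * Real.exp (-t) * Real.log t : ℝ) : ℂ) := by
    intro t ht
    rw [show ((a:ℂ) - 1) = ((a - 1 : ℝ) : ℂ) by push_cast; rfl,
      ← Complex.ofReal_cpow (le_of_lt ht)]
    push_cast
    ring
  constructor
  · unfold MellinConvergent at H
    have H2 := (integrableOn_congr_fun (g := fun t : ℝ => ((t ^ (a - 1) * Real.exp (-t) * Real.log t : ℝ) : ℂ)) (fun t ht => by
      refine Eq.trans ?_ (eqn t ht); simp [Complex.real_smul]) measurableSet_Ioi).1 H
    exact H2.re
  · rw [setIntegral_congr_fun measurableSet_Ioi eqn, integral_complex_ofReal] at D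
    have D2 : HasDerivAt Complex.Gamma _ (a:ℂ) := D.congr_of_eventuallyEq (by
      have : IsOpen {s : ℂ | 0 < s.re} := Complex.continuous_re.isOpen_preimage _ isOpen_Ioi
      filter_upwards [this.mem_nhds hre] with a using Complex.Gamma_eq_integral)
    have D3 := D2.real_of_complex
    simp only [Complex.ofReal_re] at D3
    exact D3.deriv

lemma LL_radial (n : ℕ) (hn : 1 ≤ n) (g : ℝ → ℝ) :
    ∫ y : EuclideanSpace ℝ (Fin n), g (‖y‖ ^ 2) =
      Real.pi ^ ((n:ℝ)/2) / Real.Gamma ((n:ℝ)/2) *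
        ∫ s in Set.Ioi (0:ℝ), s ^ ((n:ℝ)/2 - 1) * g s := by
  have : Nonempty (Fin n) := ⟨⟨0, hn⟩⟩
  have hn0 : (0:ℝ) < n := by exact_mod_cast hn
  have hG : 0 < Real.Gamma ((n:ℝ)/2) := Real.Gamma_pos_of_pos (by positivity)
  have h := integral_fun_norm_addHaar (volume : Measure (EuclideanSpace ℝ (Fin n)))
    (fun r => g (r^2))
  have hv : (volume : Measure (EuclideanSpace ℝ (Fin n))).real (Metric.ball 0 1) =
      Real.pi ^ ((n:ℝ)/2) / ((n:ℝ)/2 * Real.Gamma ((n:ℝ)/2)) := by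
    rw [Measure.real, EuclideanSpace.volume_ball]
    simp only [Fintype.card_fin, ENNReal.ofReal_one, one_pow, one_mul]
    rw [ENNReal.toReal_ofReal (by positivity), Real.Gamma_add_one (by positivity),
      Real.sqrt_eq_rpow, ← Real.rpow_mul_natCast (by positivity)]
    congr 2; ring
  have hc := integral_comp_rpow_Ioi (fun s => s ^ ((n:ℝ)/2 - 1) * g s) (two_ne_zero (α := ℝ))
  rw [h, hv, ← hc]
  simp only [finrank_euclideanSpace, Fintype.card_fin, smul_eq_mul, nsmul_eq_mul]
  have : ∫ x in Set.Ioi (0:ℝ), |(2:ℝ)| * x ^ ((2:ℝ) - 1) * ((x ^ (2:ℝ)) ^ ((n:ℝ)/2 - 1) * g (x ^ (2:ℝ)))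
      = 2 * ∫ y in Set.Ioi (0:ℝ), y ^ (n - 1) * g (y ^ 2) := by
    rw [← integral_const_mul]
    refine setIntegral_congr_fun measurableSet_Ioi fun s hs => ?_
    have hs : 0 < s := hs
    rw [← Real.rpow_mul hs.le, abs_of_pos two_pos, Real.rpow_two, mul_assoc, ← mul_assoc (s ^ _),
      ← Real.rpow_add hs, ← Real.rpow_natCast s (n-1), Nat.cast_sub hn]
    congr 3
    push_cast; ring
  rw [this]
  field_simp

lemma LL_kernel (n : ℕ) (hn : 1 ≤ n) (r : ℝ) (hr : 0 < r) :
    IntegrableOn (fun t : ℝ => (4 * Real.pi * t) ^ (-(n : ℝ)/2) * Real.exp (-(r ^ 2) / (4 * t)) / t)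
      (Set.Ioi 0) ∧
    ∫ t in Set.Ioi (0:ℝ), (4 * Real.pi * t) ^ (-(n : ℝ)/2) * Real.exp (-(r ^ 2) / (4 * t)) / t =
      (Real.pi ^ (-(n : ℝ)/2) * Real.Gamma ((n : ℝ)/2)) / r ^ (n:ℝ) := by
  have hn0 : (0:ℝ) < n := by exact_mod_cast hn
  have hG : 0 < Real.Gamma ((n:ℝ)/2) := Real.Gamma_pos_of_pos (by positivity)
  have val : ∫ t in Set.Ioi (0:ℝ),
      (4 * Real.pi * t) ^ (-(n : ℝ)/2) * Real.exp (-(r ^ 2) / (4 * t)) / t =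
      (Real.pi ^ (-(n : ℝ)/2) * Real.Gamma ((n : ℝ)/2)) / r ^ (n:ℝ) := by
    have hc := integral_comp_rpow_Ioi
      (fun s => (4 * Real.pi) ^ (-(n:ℝ)/2) * (s ^ ((n:ℝ)/2 - 1) * Real.exp (-((r^2/4) * s))))
      (show (-1:ℝ) ≠ 0 by norm_num)
    rw [integral_const_mul, Real.integral_rpow_mul_exp_neg_mul_Ioi (by positivity) (by positivity)]
      at hc
    have e : ∫ t in Set.Ioi (0:ℝ),
      (4 * Real.pi * t) ^ (-(n : ℝ)/2) * Real.exp (-(r ^ 2) / (4 * t)) / t =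
        (4 * π) ^ (-(n:ℝ) / 2) * ((1 / (r ^ 2 / 4)) ^ ((n:ℝ) / 2) * Gamma ((n:ℝ) / 2)) := by
      refine Eq.trans ?_ hc
      refine setIntegral_congr_fun measurableSet_Ioi fun t ht => ?_
      have ht : 0 < t := ht
      simp only [smul_eq_mul]
      rw [Real.mul_rpow (by positivity) ht.le, ← Real.rpow_mul ht.le, abs_neg, abs_one, one_mul,
        Real.rpow_neg_one]
      have e1 : -(r^2)/(4*t) = -(r^2/4 * t⁻¹) := by field_simp
      have e2 : t ^ (-(n:ℝ)/2) / t = t ^ ((-1:ℝ)-1) * t ^ (-1 * ((n:ℝ)/2 - 1)) := by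
        rw [← Real.rpow_add ht, ← Real.rpow_sub_one ht.ne']
        congr 1; ring
      rw [e1]
      calc _ = (4 * Real.pi) ^ (-(n:ℝ)/2) * (t ^ (-(n:ℝ)/2) / t) * Real.exp (-(r^2/4 * t⁻¹)) := by
            ring
        _ = _ := by rw [e2]; ring
    rw [e, Real.mul_rpow (by norm_num) Real.pi_pos.le, one_div_div, Real.div_rpow (by norm_num) (by positivity),
      ← Real.rpow_natCast r 2, ← Real.rpow_mul hr.le, neg_div, Real.rpow_neg (by norm_num : (0:ℝ) ≤ 4)]
    have : ((2:ℕ):ℝ) * ((n:ℝ)/2) = n := by push_cast; ring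
    rw [this]
    have : (0:ℝ) < 4 ^ ((n:ℝ)/2) := by positivity
    field_simp
  refine ⟨?_, val⟩
  by_contra hne
  rw [integral_undef hne] at val
  have : 0 < (Real.pi ^ (-(n : ℝ)/2) * Real.Gamma ((n : ℝ)/2)) / r ^ (n:ℝ) := by positivity
  linarith

lemma LL_fubini (n : ℕ) (hn : 1 ≤ n) (x : EuclideanSpace ℝ (Fin n))
    (S : Set (EuclideanSpace ℝ (Fin n))) (g : EuclideanSpace ℝ (Fin n) → ℝ) (hg : Measurable g)
    (hint : IntegrableOn (fun y => g y / dist x y ^ (n:ℝ)) S) :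
    IntegrableOn (fun t : ℝ => ((4 * Real.pi * t) ^ (-(n : ℝ)/2) *
      ∫ y in S, Real.exp (-(dist x y ^ 2) / (4 * t)) * g y) / t) (Set.Ioi 0) ∧
    ∫ t in Set.Ioi (0:ℝ), ((4 * Real.pi * t) ^ (-(n : ℝ)/2) *
      ∫ y in S, Real.exp (-(dist x y ^ 2) / (4 * t)) * g y) / t =
      (Real.pi ^ (-(n : ℝ)/2) * Real.Gamma ((n : ℝ)/2)) * ∫ y in S, g y / dist x y ^ (n:ℝ) := by
  have : Nonempty (Fin n) := ⟨⟨0, hn⟩⟩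
  have hn0 : (0:ℝ) < n := by exact_mod_cast hn
  have hG : 0 < Real.Gamma ((n:ℝ)/2) := Real.Gamma_pos_of_pos (by positivity)
  set K : EuclideanSpace ℝ (Fin n) → ℝ → ℝ := fun y t =>
    (4 * Real.pi * t) ^ (-(n : ℝ)/2) * Real.exp (-(dist x y ^ 2) / (4 * t)) / t * g y with hK
  have hmeas : Measurable (Function.uncurry K) := by
    have : Measurable (fun p : EuclideanSpace ℝ (Fin n) × ℝ => g p.1) := hg.comp measurable_fst
    simp only [hK, Function.uncurry_def]
    fun_prop
  have hae : ∀ᵐ y ∂(volume.restrict S), 0 < dist x y := by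
    refine ae_restrict_of_ae ?_
    have : ∀ᵐ y ∂(volume : Measure (EuclideanSpace ℝ (Fin n))), y ≠ x := by
      simp [ae_iff]
    filter_upwards [this] with y hy
    exact dist_pos.2 (Ne.symm hy)
  have hI : Integrable (Function.uncurry K)
      ((volume.restrict S).prod (volume.restrict (Set.Ioi (0:ℝ)))) := by
    rw [integrable_prod_iff hmeas.aestronglyMeasurable]
    constructor
    · filter_upwards [hae] with y hy
      exact (LL_kernel n hn _ hy).1.mul_const (g y)
    · refine (hint.norm.const_mul (Real.pi ^ (-(n : ℝ)/2) * Real.Gamma ((n : ℝ)/2))).congr ?_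
      filter_upwards [hae] with y hy
      have : ∫ t in Set.Ioi (0:ℝ), ‖Function.uncurry K (y, t)‖ =
        ∫ t in Set.Ioi (0:ℝ), (4 * Real.pi * t) ^ (-(n : ℝ)/2) *
          Real.exp (-(dist x y ^ 2) / (4 * t)) / t * ‖g y‖ := by
        refine setIntegral_congr_fun measurableSet_Ioi fun t ht => ?_
        have ht : 0 < t := ht
        simp only [hK, Function.uncurry_apply_pair]
        rw [norm_mul, Real.norm_of_nonneg (by positivity)]
      rw [this, integral_mul_const, (LL_kernel n hn _ hy).2, norm_div,
        Real.norm_of_nonneg (by positivity : 0 ≤ dist x y ^ (n:ℝ))]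
      ring
  have inner : ∀ t : ℝ, ∫ y in S, K y t = ((4 * Real.pi * t) ^ (-(n : ℝ)/2) *
      ∫ y in S, Real.exp (-(dist x y ^ 2) / (4 * t)) * g y) / t := by
    intro t
    rw [← integral_const_mul, ← integral_div]
    congr 1; ext y; simp only [hK]; ring
  have h1 := hI.integral_prod_right
  have h2 := integral_integral_swap hI
  simp only [Function.uncurry_apply_pair] at h1
  simp_rw [inner] at h1 h2
  refine ⟨h1, h2.symm.trans ?_⟩
  rw [← integral_const_mul]
  refine integral_congr_ae ?_
  filter_upwards [hae] with y hy
  simp only [hK]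
  rw [integral_mul_const, (LL_kernel n hn _ hy).2]
  ring

lemma LL_mass (n : ℕ) (hn : 1 ≤ n) (x : EuclideanSpace ℝ (Fin n)) (t : ℝ) (ht : 0 < t) :
    (4 * Real.pi * t) ^ (-(n : ℝ)/2) *
      ∫ y in Metric.ball x 1, Real.exp (-(dist x y ^ 2) / (4 * t)) =
    ∫ s in Set.Ioi (0:ℝ), (1 / Real.Gamma ((n:ℝ)/2) * (s ^ ((n:ℝ)/2 - 1) * Real.exp (-s))) *
      (if t < 1 / (4 * s) then (1:ℝ) else 0) := by
  have hn0 : (0:ℝ) < n := by exact_mod_cast hn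
  have hG : 0 < Real.Gamma ((n:ℝ)/2) := Real.Gamma_pos_of_pos (by positivity)
  set g : ℝ → ℝ := fun s => if s < 1 then Real.exp (-s / (4 * t)) else 0 with hg
  have e1 : ∫ y in Metric.ball x 1, Real.exp (-(dist x y ^ 2) / (4 * t)) =
      ∫ y : EuclideanSpace ℝ (Fin n), g (‖y‖ ^ 2) := by
    rw [← integral_indicator measurableSet_ball, ← integral_add_right_eq_self _ x]
    congr 1; ext y
    simp only [Set.indicator, Metric.mem_ball, hg]
    rw [dist_comm x (y + x), dist_eq_norm, add_sub_cancel_right]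
    simp only [sq_lt_one_iff₀ (norm_nonneg y)]
  have e2 := integral_comp_mul_left_Ioi' (fun s => s ^ ((n:ℝ)/2 - 1) * g s) 0
    (show 0 < 4 * t by positivity)
  rw [mul_zero] at e2
  rw [e1, LL_radial n hn, ← e2, smul_eq_mul, ← mul_assoc, ← mul_assoc, ← integral_const_mul]
  refine setIntegral_congr_fun measurableSet_Ioi fun s hs => ?_
  have hs : 0 < s := hs
  have hif : (4 * t * s < 1) ↔ t < 1 / (4 * s) := by
    rw [lt_div_iff₀ (by positivity)]
    constructor <;> intro h <;> linarith
  simp only [hg]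
  by_cases h : t < 1 / (4 * s)
  · rw [if_pos h, if_pos (hif.2 h)]
    have : -(4 * t * s) / (4 * t) = -s := by field_simp
    rw [this, Real.mul_rpow (by positivity) hs.le, show 4 * Real.pi * t = 4 * t * Real.pi by ring,
      Real.mul_rpow (by positivity) Real.pi_pos.le, neg_div, Real.rpow_neg (by positivity),
      Real.rpow_neg (by positivity), Real.rpow_sub_one (by positivity)]
    have : 0 < (4*t) ^ ((n:ℝ)/2) := by positivity
    have : 0 < Real.pi ^ ((n:ℝ)/2) := by positivity
    field_simp
  · rw [if_neg h, if_neg (fun h' => h (hif.1 h'))]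
    simp

lemma LL_const (n : ℕ) (hn : 1 ≤ n) (x : EuclideanSpace ℝ (Fin n)) :
    IntegrableOn (fun t : ℝ => (Real.exp (-t) - (4 * Real.pi * t) ^ (-(n : ℝ)/2) *
      ∫ y in Metric.ball x 1, Real.exp (-(dist x y ^ 2) / (4 * t))) / t) (Set.Ioi 0) ∧
    ∫ t in Set.Ioi (0:ℝ), (Real.exp (-t) - (4 * Real.pi * t) ^ (-(n : ℝ)/2) *
      ∫ y in Metric.ball x 1, Real.exp (-(dist x y ^ 2) / (4 * t))) / t =
    2 * Real.log 2 + deriv Real.Gamma ((n : ℝ)/2) / Real.Gamma ((n : ℝ)/2) -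
            Real.eulerMascheroniConstant := by
  have hn0 : (0:ℝ) < (n:ℝ)/2 := by
    have : (0:ℝ) < n := by exact_mod_cast hn
    positivity
  have hG : 0 < Real.Gamma ((n:ℝ)/2) := Real.Gamma_pos_of_pos hn0
  have gi : ∀ a : ℝ, 0 < a → IntegrableOn (fun s : ℝ => s ^ (a - 1) * Real.exp (-s)) (Set.Ioi 0) := by
    intro a ha
    refine (Real.GammaIntegral_convergent ha).congr_fun (fun s _ => mul_comm _ _) measurableSet_Ioi
  have gv : ∀ a : ℝ, 0 < a → ∫ s in Set.Ioi (0:ℝ), s ^ (a - 1) * Real.exp (-s) = Real.Gamma a := by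
    intro a ha
    rw [Real.Gamma_eq_integral ha]
    exact setIntegral_congr_fun measurableSet_Ioi (fun s _ => mul_comm _ _)
  -- first distribution: exponential
  obtain ⟨g1, g2⟩ := LL_gamma 1 one_pos
  obtain ⟨a1, a2⟩ := LL_key (fun s => s ^ ((1:ℝ) - 1) * Real.exp (-s)) (fun s => s) (by fun_prop)
    (gi 1 one_pos) (by rw [gv 1 one_pos, Real.Gamma_one]) measurable_id (fun s hs => hs) g1
  rw [← g2, Real.hasDerivAt_Gamma_one.deriv] at a2
  -- second distribution
  obtain ⟨k1, k2⟩ := LL_gamma _ hn0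
  have lg : ∀ s ∈ Set.Ioi (0:ℝ),
      1 / Real.Gamma ((n:ℝ)/2) * (s ^ ((n:ℝ)/2 - 1) * Real.exp (-s)) * Real.log (1 / (4 * s)) =
      -(2 * Real.log 2 / Real.Gamma ((n:ℝ)/2)) * (s ^ ((n:ℝ)/2 - 1) * Real.exp (-s)) -
      1 / Real.Gamma ((n:ℝ)/2) * (s ^ ((n:ℝ)/2 - 1) * Real.exp (-s) * Real.log s) := by
    intro s hs
    have hs : 0 < s := hs
    rw [one_div (4 * s), Real.log_inv, Real.log_mul (by norm_num) hs.ne',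
      show (4:ℝ) = 2 ^ 2 by norm_num, Real.log_pow]
    push_cast
    ring
  have li := ((gi _ hn0).const_mul (-(2 * Real.log 2 / Real.Gamma ((n:ℝ)/2)))).sub
    (k1.const_mul (1 / Real.Gamma ((n:ℝ)/2)))
  obtain ⟨b1, b2⟩ := LL_key
    (fun s => 1 / Real.Gamma ((n:ℝ)/2) * (s ^ ((n:ℝ)/2 - 1) * Real.exp (-s)))
    (fun s => 1 / (4 * s)) (by fun_prop)
    ((gi _ hn0).const_mul _) (by rw [integral_const_mul, gv _ hn0]; field_simp)
    (by fun_prop) (fun s hs => by positivity)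
    (IntegrableOn.congr_fun li (fun s hs => (lg s hs).symm) measurableSet_Ioi)
  rw [setIntegral_congr_fun measurableSet_Ioi lg, integral_sub
    ((gi _ hn0).const_mul _) (k1.const_mul _), integral_const_mul, integral_const_mul,
    gv _ hn0, ← k2] at b2
  have key : ∀ t ∈ Set.Ioi (0:ℝ), (Real.exp (-t) - (4 * Real.pi * t) ^ (-(n : ℝ)/2) *
      ∫ y in Metric.ball x 1, Real.exp (-(dist x y ^ 2) / (4 * t))) / t =
      ((∫ s in Set.Ioi (0:ℝ), s ^ ((1:ℝ) - 1) * Real.exp (-s) * (if t < s then (1:ℝ) else 0))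
      - (if t < 1 then (1:ℝ) else 0)) / t -
      ((∫ s in Set.Ioi (0:ℝ), (1 / Real.Gamma ((n:ℝ)/2) * (s ^ ((n:ℝ)/2 - 1) * Real.exp (-s))) *
      (if t < 1 / (4 * s) then (1:ℝ) else 0)) - (if t < 1 then (1:ℝ) else 0)) / t := by
    intro t ht
    have ht : 0 < t := ht
    rw [LL_mass n hn x t ht]
    have : ∫ s in Set.Ioi (0:ℝ), s ^ ((1:ℝ) - 1) * Real.exp (-s) * (if t < s then (1:ℝ) else 0)
        = Real.exp (-t) := by
      rw [← integral_exp_neg_Ioi t]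
      have e : ∀ s : ℝ, s ^ ((1:ℝ) - 1) * Real.exp (-s) * (if t < s then (1:ℝ) else 0) =
          Set.indicator (Set.Ioi t) (fun s => Real.exp (-s)) s := by
        intro s
        by_cases h : t < s <;> simp [Set.indicator, h]
      simp_rw [e]
      rw [integral_indicator measurableSet_Ioi, Measure.restrict_restrict measurableSet_Ioi,
        Set.inter_eq_left.2 (Set.Ioi_subset_Ioi ht.le)]
    rw [this]
    ring
  constructor
  · exact IntegrableOn.congr_fun (a1.sub b1) (fun t ht => (key t ht).symm) measurableSet_Ioi
  · rw [setIntegral_congr_fun measurableSet_Ioi key, integral_sub a1 b1, a2, b2]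
    field_simp
    ring

lemma LL_dist_int (n : ℕ) (hn : 1 ≤ n) (x : EuclideanSpace ℝ (Fin n)) (β : ℝ) (hβ : 0 < β) :
    IntegrableOn (fun y => dist x y ^ (β - n)) (Metric.ball x 1) := by
  have : Nonempty (Fin n) := ⟨⟨0, hn⟩⟩
  have h0 : IntegrableOn (fun y : EuclideanSpace ℝ (Fin n) => ‖y‖ ^ (β - n)) (Metric.ball 0 1) := by
    rw [integrableOn_fun_norm_addHaar volume (f := fun r : ℝ => r ^ (β - n))]
    simp only [finrank_euclideanSpace, Fintype.card_fin, smul_eq_mul]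
    refine IntegrableOn.congr_fun (f := fun r : ℝ => r ^ (β - 1))
      ((intervalIntegral.integrableOn_Ioo_rpow_iff one_pos).2 (by linarith)) ?_ measurableSet_Ioo
    intro r hr
    simp only
    rw [← Real.rpow_natCast, ← Real.rpow_add hr.1, Nat.cast_sub hn]
    congr 1; push_cast; ring
  rw [← integrable_indicator_iff measurableSet_ball] at h0 ⊢
  refine (h0.comp_sub_right x).congr (Filter.Eventually.of_forall fun y => ?_)
  simp only [Set.indicator, Metric.mem_ball, dist_zero_right]
  rw [dist_comm x y, dist_eq_norm]

/-- The Bochner-integral definition of the logarithmic Laplacian on `ℝⁿ` coincides with the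
classical Chen–Weth pointwise representation: for `f` compactly supported and Hölder continuous
of exponent `β ∈ (0,1]`, and every `x`,
`∫₀^∞ (e^{-t} f(x) − (4πt)^{-n/2} ∫ e^{-|x−y|²/(4t)} f(y) dy)/t dt` converges and equals
`c_n ∫_{B₁(x)} (f(x)−f(y))/|x−y|ⁿ dy − c_n ∫_{ℝⁿ∖B₁(x)} f(y)/|x−y|ⁿ dy + ρ_n f(x)`. -/
theorem logLaplacian_pointwise_repr_rn (n : ℕ) (hn : 1 ≤ n)
    (f : EuclideanSpace ℝ (Fin n) → ℝ) (hf_supp : HasCompactSupport f)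
    (β : ℝ) (hβ : β ∈ Set.Ioc (0 : ℝ) 1)
    (hf_holder : ∃ C : ℝ, ∀ x y : EuclideanSpace ℝ (Fin n),
      |f x - f y| ≤ C * dist x y ^ β)
    (x : EuclideanSpace ℝ (Fin n)) :
    IntegrableOn (fun t : ℝ =>
        (Real.exp (-t) * f x -
          (4 * Real.pi * t) ^ (-(n : ℝ)/2) *
            ∫ y, Real.exp (-(dist x y ^ 2) / (4 * t)) * f y) / t)
      (Set.Ioi 0) ∧
    (∫ t in Set.Ioi (0 : ℝ),
        (Real.exp (-t) * f x -
          (4 * Real.pi * t) ^ (-(n : ℝ)/2) *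
            ∫ y, Real.exp (-(dist x y ^ 2) / (4 * t)) * f y) / t) =
      (Real.pi ^ (-(n : ℝ)/2) * Real.Gamma ((n : ℝ)/2)) *
          (∫ y in Metric.ball x 1, (f x - f y) / dist x y ^ (n : ℝ)) -
        (Real.pi ^ (-(n : ℝ)/2) * Real.Gamma ((n : ℝ)/2)) *
          (∫ y in (Metric.ball x 1)ᶜ, f y / dist x y ^ (n : ℝ)) +
        (2 * Real.log 2 + deriv Real.Gamma ((n : ℝ)/2) / Real.Gamma ((n : ℝ)/2) -
            Real.eulerMascheroniConstant) * f x := by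
  have hne : Nonempty (Fin n) := ⟨⟨0, hn⟩⟩
  obtain ⟨C, hC⟩ := hf_holder
  have hcont : Continuous f := by
    rw [continuous_iff_continuousAt]
    intro z
    rw [ContinuousAt, tendsto_iff_dist_tendsto_zero]
    refine squeeze_zero (fun _ => dist_nonneg) (fun y => ?_) (g := fun y => C * dist y z ^ β) ?_
    · rw [Real.dist_eq]; exact hC y z
    · have : Continuous (fun y : EuclideanSpace ℝ (Fin n) => C * dist y z ^ β) :=
        continuous_const.mul ((continuous_id.dist continuous_const).rpow_const
          (fun _ => Or.inr hβ.1.le))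
      have h := this.tendsto z
      simpa [Real.zero_rpow hβ.1.ne'] using h
  have hfint : Integrable f := hcont.integrable_of_hasCompactSupport hf_supp
  have hae : ∀ᵐ y ∂(volume : Measure (EuclideanSpace ℝ (Fin n))), y ≠ x := by
    simp [ae_iff]
  have i1 : IntegrableOn (fun y => (f x - f y) / dist x y ^ (n:ℝ)) (Metric.ball x 1) := by
    refine Integrable.mono ((LL_dist_int n hn x β hβ.1).const_mul C)
      (by have := hcont.measurable; exact Measurable.aestronglyMeasurable (by fun_prop)) ?_
    refine ae_restrict_of_ae ?_
    filter_upwards [hae] with y hy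
    have hd : 0 < dist x y := dist_pos.2 (Ne.symm hy)
    rw [norm_div, Real.norm_eq_abs, Real.norm_of_nonneg (by positivity : 0 ≤ dist x y ^ (n:ℝ)),
      Real.rpow_sub hd, ← mul_div_assoc]
    refine le_trans ?_ (le_abs_self _)
    gcongr
    exact hC x y
  have i2 : IntegrableOn (fun y => f y / dist x y ^ (n:ℝ)) (Metric.ball x 1)ᶜ := by
    refine Integrable.mono hfint.integrableOn
      (by have := hcont.measurable; exact Measurable.aestronglyMeasurable (by fun_prop)) ?_
    filter_upwards [ae_restrict_mem measurableSet_ball.compl] with y hy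
    have hd : 1 ≤ dist x y := by
      rw [dist_comm]; simpa using hy
    rw [norm_div]
    refine div_le_self (norm_nonneg _) ?_
    rw [Real.norm_of_nonneg (by positivity)]
    exact Real.one_le_rpow hd (by positivity)
  obtain ⟨p1, p2⟩ := LL_fubini n hn x (Metric.ball x 1) (fun y => f x - f y)
    (measurable_const.sub hcont.measurable) i1
  obtain ⟨q1, q2⟩ := LL_fubini n hn x (Metric.ball x 1)ᶜ f hcont.measurable i2
  obtain ⟨r1, r2⟩ := LL_const n hn x
  have key : ∀ t ∈ Set.Ioi (0:ℝ), (Real.exp (-t) * f x -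
          (4 * Real.pi * t) ^ (-(n : ℝ)/2) *
            ∫ y, Real.exp (-(dist x y ^ 2) / (4 * t)) * f y) / t =
      (((4 * Real.pi * t) ^ (-(n : ℝ)/2) *
        ∫ y in Metric.ball x 1, Real.exp (-(dist x y ^ 2) / (4 * t)) * (f x - f y)) / t -
      ((4 * Real.pi * t) ^ (-(n : ℝ)/2) *
        ∫ y in (Metric.ball x 1)ᶜ, Real.exp (-(dist x y ^ 2) / (4 * t)) * f y) / t) +
      ((Real.exp (-t) - (4 * Real.pi * t) ^ (-(n : ℝ)/2) *
        ∫ y in Metric.ball x 1, Real.exp (-(dist x y ^ 2) / (4 * t))) / t) * f x := by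
    intro t ht
    have ht : 0 < t := ht
    have ci : Continuous (fun y : EuclideanSpace ℝ (Fin n) =>
        Real.exp (-(dist x y ^ 2) / (4 * t))) := by fun_prop
    have j1 : Integrable (fun y => Real.exp (-(dist x y ^ 2) / (4 * t)) * f y) :=
      (ci.mul hcont).integrable_of_hasCompactSupport hf_supp.mul_left
    have j2 : IntegrableOn (fun y => Real.exp (-(dist x y ^ 2) / (4 * t))) (Metric.ball x 1) :=
      (ci.continuousOn.integrableOn_compact (isCompact_closedBall x 1)).mono_set
        Metric.ball_subset_closedBall
    rw [← integral_add_compl (measurableSet_ball (x := x) (ε := 1)) j1]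
    have e : ∫ y in Metric.ball x 1, Real.exp (-(dist x y ^ 2) / (4 * t)) * (f x - f y) =
        (∫ y in Metric.ball x 1, Real.exp (-(dist x y ^ 2) / (4 * t))) * f x -
        ∫ y in Metric.ball x 1, Real.exp (-(dist x y ^ 2) / (4 * t)) * f y := by
      rw [← integral_mul_const, ← integral_sub (j2.mul_const _) j1.integrableOn]
      simp_rw [mul_sub]
    rw [e]
    ring
  constructor
  · exact IntegrableOn.congr_fun ((p1.sub q1).add (r1.mul_const (f x)))
      (fun t ht => (key t ht).symm) measurableSet_Ioi
  · rw [setIntegral_congr_fun measurableSet_Ioi key,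
      ← r2, ← q2, ← p2, ← integral_sub p1 q1, ← integral_mul_const]
    exact integral_add (p1.sub q1) (r1.mul_const (f x))
end

section
/- Let n ≥ 2 be an integer and s ≥ 0, and define J(n,r) = ∫₀^{r²/4} t^{n/2+s−1} exp(−(n−1)² r²/(16t) − t) · (1 + r + r²/(4t))^{(n−3)/2} dt for r > 0. Then there exist constants c₁, c₂ > 0 (depending only on n and s) such that c₁ r^{n+s−2} e^{−(n−1)r/2} ≤ J(n,r) ≤ c₂ r^{n+s−2} e^{−(n−1)r/2} for all r ≥ 1. -/
open MeasureTheory Real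

lemma lap_rpow_exp_bdd (q c : ℝ) (hc : 0 < c) (hq : 0 ≤ q) :
    ∃ C : ℝ, 0 < C ∧ ∀ x : ℝ, 0 < x → x ^ q * Real.exp (-(c * x)) ≤ C := by
  obtain ⟨k, hk⟩ := exists_nat_ge q
  refine ⟨1 + k.factorial / c ^ k, by positivity, fun x hx => ?_⟩
  have h1 : x ^ q ≤ 1 + x ^ k := by
    rcases le_total x 1 with h | h
    · have := Real.rpow_le_one hx.le h hq
      have : 0 ≤ x ^ k := by positivity
      linarith
    · have := Real.rpow_le_rpow_of_exponent_le h hk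
      rw [Real.rpow_natCast] at this
      linarith
  have h2 : (c * x) ^ k / k.factorial ≤ Real.exp (c * x) :=
    Real.pow_div_factorial_le_exp _ (by positivity) k
  have h3 : x ^ k ≤ k.factorial / c ^ k * Real.exp (c * x) := by
    rw [mul_pow] at h2
    have hck : 0 < c ^ k := by positivity
    have hf : (0:ℝ) < k.factorial := by positivity
    rw [div_le_iff₀ hf] at h2
    rw [div_mul_eq_mul_div, le_div_iff₀ hck]
    linarith
  have h4 : (1:ℝ) ≤ Real.exp (c * x) := Real.one_le_exp (by positivity)
  rw [Real.exp_neg, ← div_eq_mul_inv, div_le_iff₀ (Real.exp_pos _)]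
  nlinarith

/-- the substitution -/
noncomputable def lapPhi (b t : ℝ) : ℝ := √t - b / √t

noncomputable def lapDer (b t : ℝ) : ℝ := 1 / (2 * √t) + b / (2 * (t * √t))

lemma lapPhi_sq (b t : ℝ) (ht : 0 < t) : lapPhi b t ^ 2 = t - 2 * b + b ^ 2 / t := by
  have h1 : 0 < √t := Real.sqrt_pos.2 ht
  have h2 : √t ^ 2 = t := Real.sq_sqrt ht.le
  unfold lapPhi
  have : (√t - b / √t) ^ 2 = √t ^ 2 - 2 * b + b ^ 2 / √t ^ 2 := by
    field_simp
    ring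
  rw [this, h2]

lemma lapPhi_deriv (b t : ℝ) (ht : 0 < t) : HasDerivAt (lapPhi b) (lapDer b t) t := by
  have h1 : 0 < √t := Real.sqrt_pos.2 ht
  have h2 : √t ^ 2 = t := Real.sq_sqrt ht.le
  have h := (Real.hasDerivAt_sqrt ht.ne').sub
    ((hasDerivAt_const t b).div (Real.hasDerivAt_sqrt ht.ne') h1.ne')
  have e : lapDer b t = 1 / (2 * √t) - (0 * √t - b * (1 / (2 * √t))) / √t ^ 2 := by
    unfold lapDer
    rw [h2]
    field_simp
    ring
  rw [e]
  exact h

lemma lapDer_pos (b t : ℝ) (hb : 0 < b) (ht : 0 < t) : 0 < lapDer b t := by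
  unfold lapDer
  have h1 : 0 < √t := Real.sqrt_pos.2 ht
  positivity

lemma lapPhi_inj (b T : ℝ) (hb : 0 < b) : Set.InjOn (lapPhi b) (Set.Ioc 0 T) := by
  have : StrictMonoOn (lapPhi b) (Set.Ioc 0 T) := by
    intro x hx y hy hxy
    unfold lapPhi
    have h1 : 0 < √x := Real.sqrt_pos.2 hx.1
    have h2 : √x < √y := Real.sqrt_lt_sqrt hx.1.le hxy
    have := div_lt_div_of_pos_left hb h1 h2
    linarith
  exact this.injOn

lemma lap_gauss (b T : ℝ) (hb : 0 < b) :
    IntegrableOn (fun t => lapDer b t * Real.exp (-(1/2) * lapPhi b t ^ 2)) (Set.Ioc 0 T) ∧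
    ∫ t in Set.Ioc 0 T, lapDer b t * Real.exp (-(1/2) * lapPhi b t ^ 2) ≤ √(π / (1/2)) := by
  have hd : ∀ x ∈ Set.Ioc 0 T, HasDerivWithinAt (lapPhi b) (lapDer b x) (Set.Ioc 0 T) x :=
    fun x hx => (lapPhi_deriv b x hx.1).hasDerivWithinAt
  have hg : Integrable (fun x : ℝ => Real.exp (-(1/2) * x ^ 2)) :=
    integrable_exp_neg_mul_sq (by norm_num)
  have heq : ∀ t ∈ Set.Ioc 0 T, |lapDer b t| • Real.exp (-(1/2) * lapPhi b t ^ 2)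
      = lapDer b t * Real.exp (-(1/2) * lapPhi b t ^ 2) := by
    intro t ht
    rw [abs_of_pos (lapDer_pos b t hb ht.1), smul_eq_mul]
  constructor
  · have := (integrableOn_image_iff_integrableOn_abs_deriv_smul measurableSet_Ioc hd
      (lapPhi_inj b T hb) (fun x : ℝ => Real.exp (-(1/2) * x ^ 2))).1 hg.integrableOn
    exact this.congr_fun heq measurableSet_Ioc
  · rw [← setIntegral_congr_fun measurableSet_Ioc heq,
      ← integral_image_eq_integral_abs_deriv_smul measurableSet_Ioc hd
      (lapPhi_inj b T hb) (fun x : ℝ => Real.exp (-(1/2) * x ^ 2)), ← integral_gaussian]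
    exact setIntegral_le_integral hg (Filter.Eventually.of_forall fun x => (Real.exp_pos _).le)

lemma lap_pointwise (a p m : ℝ) (ha : 0 < a) (hp : 0 ≤ p) :
    ∃ C : ℝ, 0 < C ∧ ∀ r t : ℝ, 1 ≤ r → 0 < t →
      t ^ p * Real.exp (-(a ^ 2 * r ^ 2 / t) - t) * (1 + r + r ^ 2 / (4 * t)) ^ m ≤
      (C * r ^ (p + m + 1/2) * Real.exp (-(2 * a * r))) *
        (lapDer (a * r) t * Real.exp (-(1/2) * lapPhi (a * r) t ^ 2)) := by
  obtain ⟨C1, hC1, h1⟩ := lap_rpow_exp_bdd (p + 3/2) (1/2) (by norm_num) (by linarith)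
  obtain ⟨C2, hC2, h2⟩ := lap_rpow_exp_bdd (max m 0) (2 * a ^ 2) (by positivity) (le_max_right _ _)
  refine ⟨(2 / a) * Real.exp (a + 4 * a ^ 2) * C1 * C2, by positivity, fun r t hr ht => ?_⟩
  have hr0 : 0 < r := by linarith
  obtain ⟨u, rfl⟩ : ∃ u, t = r * u := ⟨t / r, by field_simp⟩
  have hu : 0 < u := by
    by_contra h
    push Not at h
    nlinarith
  set φ := lapPhi (a * r) (r * u) with hφ
  have hsq : φ ^ 2 = r * (u - 2 * a + a ^ 2 / u) := by
    rw [hφ, lapPhi_sq _ _ ht]; field_simp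
  have hw : 0 ≤ u - 2 * a + a ^ 2 / u := by
    have : u - 2 * a + a ^ 2 / u = (u - a) ^ 2 / u := by field_simp; ring
    rw [this]; positivity
  have hsq2 : u - 2 * a + a ^ 2 / u ≤ φ ^ 2 := by rw [hsq]; nlinarith
  set x := 2 + 1 / (4 * u) with hx
  have hx0 : 0 < x := by positivity
  have hX : 1 + r + r ^ 2 / (4 * (r * u)) = r * (1 / r + 1 + 1 / (4 * u)) := by
    field_simp
  set y := 1 / r + 1 + 1 / (4 * u) with hy
  have hy1 : 1 ≤ y := by
    have : 0 < 1 / r := by positivity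
    have : 0 < 1 / (4 * u) := by positivity
    linarith
  have hyx : y ≤ x := by
    have : 1 / r ≤ 1 := by rw [div_le_one hr0]; exact hr
    linarith
  have hym : y ^ m ≤ x ^ (max m 0) :=
    (Real.rpow_le_rpow_of_exponent_le hy1 (le_max_left _ _)).trans
      (Real.rpow_le_rpow (by linarith) hyx (le_max_right _ _))
  have hexp : Real.exp (-(1/2) * φ ^ 2) ≤
      Real.exp (a + 4 * a ^ 2) * Real.exp (-(1/2 * u)) * Real.exp (-(2 * a ^ 2 * x)) := by
    rw [← Real.exp_add, ← Real.exp_add]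
    apply Real.exp_le_exp.2
    have : 2 * a ^ 2 * x = 4 * a ^ 2 + a ^ 2 / u / 2 := by rw [hx]; field_simp; ring
    rw [this]; linarith
  have hE : Real.exp (-(a ^ 2 * r ^ 2 / (r * u)) - r * u) =
      Real.exp (-(2 * a * r)) * (Real.exp (-(1/2) * φ ^ 2) * Real.exp (-(1/2) * φ ^ 2)) := by
    rw [← Real.exp_add, ← Real.exp_add, hsq]
    congr 1
    field_simp
    ring
  have key : u ^ (p + 3/2) * y ^ m * Real.exp (-(1/2) * φ ^ 2) ≤
      Real.exp (a + 4 * a ^ 2) * C1 * C2 := by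
    calc _ ≤ u ^ (p + 3/2) * x ^ (max m 0) * (Real.exp (a + 4 * a ^ 2) * Real.exp (-(1/2 * u)) * Real.exp (-(2 * a ^ 2 * x))) := by
          gcongr
      _ = Real.exp (a + 4 * a ^ 2) * (u ^ (p + 3/2) * Real.exp (-(1/2 * u))) *
          (x ^ (max m 0) * Real.exp (-(2 * a ^ 2 * x))) := by ring
      _ ≤ _ := by
          have := h1 u hu
          have := h2 x hx0
          gcongr
  have hder : a / (2 * (r ^ (1/2:ℝ) * u ^ (3/2:ℝ))) ≤ lapDer (a * r) (r * u) := by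
    unfold lapDer
    have e : a / (2 * (r ^ (1/2:ℝ) * u ^ (3/2:ℝ))) = a * r / (2 * (r * u * √(r * u))) := by
      have : u ^ (3/2:ℝ) = u * √u := by
        rw [Real.sqrt_eq_rpow, ← Real.rpow_one_add' hu.le (by norm_num)]; norm_num
      rw [this, ← Real.sqrt_eq_rpow, Real.sqrt_mul hr0.le]
      have := Real.sqrt_pos.2 hr0
      have := Real.sqrt_pos.2 hu
      field_simp
    rw [e]
    have : 0 ≤ 1 / (2 * √(r * u)) := by positivity
    linarith
  rw [hX, hE, Real.mul_rpow hr0.le hu.le, Real.mul_rpow hr0.le (by linarith)]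
  have hup : u ^ p = u ^ (p + 3/2) / u ^ (3/2:ℝ) := by
    rw [← Real.rpow_sub hu]; ring_nf
  have hrp : r ^ (p + m + 1/2) = r ^ p * r ^ m * r ^ (1/2:ℝ) := by
    rw [Real.rpow_add hr0, Real.rpow_add hr0]
  have hr2 : 0 < r ^ (1/2:ℝ) := by positivity
  have hu2 : 0 < u ^ (3/2:ℝ) := by positivity
  rw [hup, hrp]
  set E := Real.exp (-(1/2) * φ ^ 2)
  calc _ = (u ^ (p + 3/2) * y ^ m * E) * (r ^ p * r ^ m / u ^ (3/2:ℝ) * Real.exp (-(2 * a * r)) * E) := by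
        ring
    _ ≤ (Real.exp (a + 4 * a ^ 2) * C1 * C2) * (r ^ p * r ^ m / u ^ (3/2:ℝ) * Real.exp (-(2 * a * r)) * E) := by
        have : 0 < E := Real.exp_pos _
        gcongr
    _ = (2 / a * Real.exp (a + 4 * a ^ 2) * C1 * C2 * (r ^ p * r ^ m * r ^ (1/2:ℝ)) * Real.exp (-(2 * a * r))) * (a / (2 * (r ^ (1/2:ℝ) * u ^ (3/2:ℝ))) * E) := by
        field_simp
    _ ≤ _ := by
        have : 0 < E := Real.exp_pos _
        gcongr

lemma lap_upper (a p m : ℝ) (ha : 0 < a) (hp : 0 ≤ p) :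
    ∃ C : ℝ, 0 < C ∧ ∀ r : ℝ, 1 ≤ r →
      IntegrableOn (fun t => t ^ p * Real.exp (-(a ^ 2 * r ^ 2 / t) - t) *
        (1 + r + r ^ 2 / (4 * t)) ^ m) (Set.Ioc 0 (r ^ 2 / 4)) ∧
      ∫ t in Set.Ioc 0 (r ^ 2 / 4), t ^ p * Real.exp (-(a ^ 2 * r ^ 2 / t) - t) *
        (1 + r + r ^ 2 / (4 * t)) ^ m ≤ C * r ^ (p + m + 1/2) * Real.exp (-(2 * a * r)) := by
  obtain ⟨C, hC, h⟩ := lap_pointwise a p m ha hp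
  refine ⟨C * √(π / (1/2)), by positivity, fun r hr => ?_⟩
  have hr0 : 0 < r := by linarith
  obtain ⟨g1, g2⟩ := lap_gauss (a * r) (r ^ 2 / 4) (by positivity)
  have g3 := g1.const_mul (C * r ^ (p + m + 1/2) * Real.exp (-(2 * a * r)))
  have hI : IntegrableOn (fun t => t ^ p * Real.exp (-(a ^ 2 * r ^ 2 / t) - t) *
        (1 + r + r ^ 2 / (4 * t)) ^ m) (Set.Ioc 0 (r ^ 2 / 4)) := by
    refine Integrable.mono' g3 ?_ ?_
    · apply Measurable.aestronglyMeasurable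
      fun_prop
    · refine (ae_restrict_mem measurableSet_Ioc).mono fun t ht => ?_
      have ht0 := ht.1
      rw [Real.norm_of_nonneg (by positivity)]
      exact h r t hr ht0
  refine ⟨hI, ?_⟩
  calc _ ≤ ∫ t in Set.Ioc 0 (r ^ 2 / 4), (C * r ^ (p + m + 1/2) * Real.exp (-(2 * a * r))) *
        (lapDer (a * r) t * Real.exp (-(1/2) * lapPhi (a * r) t ^ 2)) :=
        setIntegral_mono_on hI g3 measurableSet_Ioc fun t ht => h r t hr ht.1
    _ ≤ (C * r ^ (p + m + 1/2) * Real.exp (-(2 * a * r))) * √(π / (1/2)) := by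
        rw [integral_const_mul]
        gcongr
    _ = _ := by ring

lemma lap_lower (a p m : ℝ) (ha : 0 < a) (hp : 0 ≤ p) :
    ∃ c : ℝ, 0 < c ∧ ∀ r : ℝ, 1 ≤ r →
      c * r ^ (p + m + 1/2) * Real.exp (-(2 * a * r)) ≤
      ∫ t in Set.Ioc 0 (r ^ 2 / 4), t ^ p * Real.exp (-(a ^ 2 * r ^ 2 / t) - t) *
        (1 + r + r ^ 2 / (4 * t)) ^ m := by
  obtain ⟨C, -, hup⟩ := lap_upper a p m ha hp
  set b := min a (1/8) with hb
  have hb0 : 0 < b := by positivity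
  have hba : b ≤ a := min_le_left _ _
  have hb8 : b ≤ 1/8 := min_le_right _ _
  set B := 2 + 1 / (4 * b) with hB
  have hB0 : 0 < B := by positivity
  set L := min 1 (B ^ m) with hL
  have hL0 : 0 < L := by positivity
  set K := (1 + (a + 1/8) ^ 2 * (8 * a)) / b with hK
  refine ⟨b ^ p * Real.exp (-K) * L * (1/8), by positivity, fun r hr => ?_⟩
  have hr0 : 0 < r := by linarith
  have hsr0 : 0 < √r := Real.sqrt_pos.2 hr0
  have hsr2 : √r ^ 2 = r := Real.sq_sqrt hr0.le
  have hsr : √r ≤ r := by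
    have : 1 ≤ √r := Real.one_le_sqrt.2 hr
    nlinarith
  obtain ⟨hI, -⟩ := hup r hr
  set t0 := min (a * r) (r ^ 2 / 8) with ht0
  have ht0r : b * r ≤ t0 := by
    apply le_min
    · gcongr
    · nlinarith
  have hbr : 0 < b * r := by positivity
  have hsub : Set.Ioc t0 (t0 + √r / 8) ⊆ Set.Ioc 0 (r ^ 2 / 4) := by
    intro t ht
    refine ⟨by linarith [ht.1], ht.2.trans ?_⟩
    have : t0 ≤ r ^ 2 / 8 := min_le_right _ _
    nlinarith
  set c := (b * r) ^ p * (Real.exp (-(2 * a * r)) * Real.exp (-K)) * (L * r ^ m) with hc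
  have hpt : ∀ t ∈ Set.Ioc t0 (t0 + √r / 8), c ≤ t ^ p * Real.exp (-(a ^ 2 * r ^ 2 / t) - t) *
        (1 + r + r ^ 2 / (4 * t)) ^ m := by
    intro t ht
    have hbt : b * r ≤ t := by linarith [ht.1]
    have htp : 0 < t := by linarith
    have htu : t ≤ (a + 1/8) * r := by
      have : t0 ≤ a * r := min_le_left _ _
      linarith [ht.2]
    have hsqb : (t - a * r) ^ 2 ≤ (1 + (a + 1/8) ^ 2 * (8 * a)) * r := by
      rcases le_total (a * r) (r ^ 2 / 8) with h | h
      · have e : t0 = a * r := min_eq_left h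
        rw [e] at ht
        have h1 : 0 ≤ t - a * r := by linarith [ht.1]
        have h2 : t - a * r ≤ √r / 8 := by linarith [ht.2]
        have h3 : (t - a * r) ^ 2 ≤ (√r / 8) ^ 2 := by gcongr
        have h4 : (√r / 8) ^ 2 = r / 64 := by rw [div_pow, hsr2]; norm_num
        have : 0 ≤ (a + 1/8) ^ 2 * (8 * a) * r := by positivity
        linarith
      · have h8 : r ≤ 8 * a := by nlinarith
        have h1 : (t - a * r) ^ 2 ≤ ((a + 1/8) * r) ^ 2 := by
          apply sq_le_sq'
          · nlinarith
          · nlinarith [mul_pos ha hr0]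
        have h2 : ((a + 1/8) * r) ^ 2 ≤ (a + 1/8) ^ 2 * (8 * a) * r := by
          have : ((a + 1/8) * r) ^ 2 = (a + 1/8) ^ 2 * r * r := by ring
          rw [this]
          have : (a + 1/8) ^ 2 * r * r ≤ (a + 1/8) ^ 2 * (8 * a) * r := by gcongr
          exact this
        linarith
    have hKt : (t - a * r) ^ 2 / t ≤ K := by
      rw [hK, div_le_div_iff₀ htp hb0]
      have h5 : 0 ≤ 1 + (a + 1/8) ^ 2 * (8 * a) := by positivity
      calc _ ≤ (1 + (a + 1/8) ^ 2 * (8 * a)) * r * b := by gcongr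
        _ = (1 + (a + 1/8) ^ 2 * (8 * a)) * (b * r) := by ring
        _ ≤ _ := by gcongr
    have hX : 1 + r + r ^ 2 / (4 * t) = (1 / r + 1 + r / (4 * t)) * r := by
      field_simp
    have hy1 : 1 ≤ 1 / r + 1 + r / (4 * t) := by
      have : 0 < 1 / r := by positivity
      have : 0 < r / (4 * t) := by positivity
      linarith
    have hyB : 1 / r + 1 + r / (4 * t) ≤ B := by
      have h1 : 1 / r ≤ 1 := by rw [div_le_one hr0]; exact hr
      have h2 : r / (4 * t) ≤ 1 / (4 * b) := by
        rw [div_le_div_iff₀ (by positivity) (by positivity)]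
        linarith
      linarith
    have hLy : L ≤ (1 / r + 1 + r / (4 * t)) ^ m := by
      rcases le_total 0 m with h | h
      · exact (min_le_left _ _).trans (Real.one_le_rpow hy1 h)
      · exact (min_le_right _ _).trans
          (Real.rpow_le_rpow_of_nonpos (by linarith) hyB h)
    rw [hc, hX, Real.mul_rpow (x := 1 / r + 1 + r / (4 * t)) (by linarith) hr0.le, ← Real.exp_add]
    have hE : -(2 * a * r) + -K ≤ -(a ^ 2 * r ^ 2 / t) - t := by
      have : (t - a * r) ^ 2 / t = t - 2 * a * r + a ^ 2 * r ^ 2 / t := by field_simp; ring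
      linarith
    gcongr
  have hlow : c * (√r / 8) ≤ ∫ t in Set.Ioc t0 (t0 + √r / 8),
      t ^ p * Real.exp (-(a ^ 2 * r ^ 2 / t) - t) * (1 + r + r ^ 2 / (4 * t)) ^ m := by
    have e : ∫ t in Set.Ioc t0 (t0 + √r / 8), c = c * (√r / 8) := by
      rw [setIntegral_const, Real.volume_real_Ioc_of_le (by linarith), smul_eq_mul]
      ring
    rw [← e]
    exact setIntegral_mono_on (integrableOn_const (by simp)) (hI.mono_set hsub) measurableSet_Ioc hpt
  have hmono : ∫ t in Set.Ioc t0 (t0 + √r / 8),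
      t ^ p * Real.exp (-(a ^ 2 * r ^ 2 / t) - t) * (1 + r + r ^ 2 / (4 * t)) ^ m ≤
      ∫ t in Set.Ioc 0 (r ^ 2 / 4),
      t ^ p * Real.exp (-(a ^ 2 * r ^ 2 / t) - t) * (1 + r + r ^ 2 / (4 * t)) ^ m := by
    refine setIntegral_mono_set hI ?_ hsub.eventuallyLE
    refine (ae_restrict_mem measurableSet_Ioc).mono fun t ht => ?_
    have ht0 := ht.1
    simp only [Pi.zero_apply]
    positivity
  refine le_trans (le_of_eq ?_) (hlow.trans hmono)
  rw [hc, Real.rpow_add hr0, Real.rpow_add hr0, Real.mul_rpow hb0.le hr0.le, Real.sqrt_eq_rpow]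
  ring

/-- Large-`r` asymptotics of the Laplace-type integral
`J(n,r) = ∫₀^{r²/4} t^{n/2+s−1} exp(−(n−1)²r²/(16t) − t) (1+r+r²/(4t))^{(n−3)/2} dt`:
there exist `c₁, c₂ > 0` with
`c₁ r^{n+s−2} e^{−(n−1)r/2} ≤ J(n,r) ≤ c₂ r^{n+s−2} e^{−(n−1)r/2}` for all `r ≥ 1`. -/
theorem laplace_integral_asymp_large (n : ℕ) (hn : 2 ≤ n) (s : ℝ) (hs : 0 ≤ s) :
    ∃ c₁ c₂ : ℝ, 0 < c₁ ∧ 0 < c₂ ∧ ∀ r : ℝ, 1 ≤ r →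
      (c₁ * r ^ ((n : ℝ) + s - 2) * Real.exp (-((n : ℝ) - 1) * r / 2) ≤
        ∫ t in Set.Ioc (0 : ℝ) (r^2/4),
          t ^ ((n : ℝ)/2 + s - 1) *
            Real.exp (-(((n : ℝ) - 1)^2 * r^2 / (16 * t)) - t) *
            (1 + r + r^2 / (4 * t)) ^ (((n : ℝ) - 3)/2)) ∧
      ((∫ t in Set.Ioc (0 : ℝ) (r^2/4),
          t ^ ((n : ℝ)/2 + s - 1) *
            Real.exp (-(((n : ℝ) - 1)^2 * r^2 / (16 * t)) - t) *
            (1 + r + r^2 / (4 * t)) ^ (((n : ℝ) - 3)/2)) ≤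
        c₂ * r ^ ((n : ℝ) + s - 2) * Real.exp (-((n : ℝ) - 1) * r / 2)) := by
  have hn' : (2:ℝ) ≤ n := by exact_mod_cast hn
  have ha : 0 < ((n:ℝ) - 1) / 4 := by linarith
  have hp : 0 ≤ (n:ℝ) / 2 + s - 1 := by linarith
  obtain ⟨c₁, h1, H1⟩ := lap_lower (((n:ℝ) - 1) / 4) ((n:ℝ) / 2 + s - 1) (((n:ℝ) - 3) / 2) ha hp
  obtain ⟨c₂, h2, H2⟩ := lap_upper (((n:ℝ) - 1) / 4) ((n:ℝ) / 2 + s - 1) (((n:ℝ) - 3) / 2) ha hp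
  refine ⟨c₁, c₂, h1, h2, fun r hr => ?_⟩
  have e1 : (n:ℝ) / 2 + s - 1 + ((n:ℝ) - 3) / 2 + 1 / 2 = (n:ℝ) + s - 2 := by ring
  have e2 : -(2 * (((n:ℝ) - 1) / 4) * r) = -((n : ℝ) - 1) * r / 2 := by ring
  have e3 : ∀ t : ℝ, (((n:ℝ) - 1) / 4) ^ 2 * r ^ 2 / t = ((n : ℝ) - 1)^2 * r^2 / (16 * t) := by
    intro t
    rw [← div_div]
    ring
  have K1 := H1 r hr
  have K2 := (H2 r hr).2
  simp only [e1, e2, e3] at K1 K2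
  exact ⟨K1, K2⟩
end

section
/- Let n ≥ 2 be an integer and define P_n(r,t) = t^{−n/2} exp(−(n−1)² t/4 − r²/(4t) − (n−1)r/2) · (1+r+t)^{(n−3)/2} · (1+r) for r, t > 0. Then there exists a constant C > 0 (depending only on n) such that C^{-1} r^{-1} e^{−(n−1)r} ≤ ∫₁^∞ P_n(r,t)/t dt ≤ C r^{-1} e^{−(n−1)r} for all r ≥ 1. -/
open MeasureTheory Real

/-- The phase variable. -/
noncomputable def phs (m r t : ℝ) : ℝ := m * √t - r / √t

/-- Derivative of the phase variable. -/
noncomputable def phs' (m r t : ℝ) : ℝ := (m * t + r) / (2 * (t * √t))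

/-- The integrand. -/
noncomputable def Kf (n : ℕ) (r t : ℝ) : ℝ :=
  (t ^ (-(n : ℝ)/2) *
            Real.exp (-(((n : ℝ) - 1)^2 * t / 4) - r^2 / (4 * t) - ((n : ℝ) - 1) * r / 2) *
            (1 + r + t) ^ (((n : ℝ) - 3)/2) * (1 + r)) / t

lemma phs_sq (m r t : ℝ) (ht : 0 < t) : phs m r t ^ 2 = (m * t - r) ^ 2 / t := by
  unfold phs
  have h1 : 0 < √t := Real.sqrt_pos.2 ht
  have h2 : √t ^ 2 = t := Real.sq_sqrt ht.le
  generalize √t = u at *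
  subst h2
  field_simp

lemma phs_deriv (m r t : ℝ) (ht : 0 < t) : HasDerivAt (phs m r) (phs' m r t) t := by
  have h1 : 0 < √t := Real.sqrt_pos.2 ht
  have h2 : √t ^ 2 = t := Real.sq_sqrt ht.le
  have h := (Real.hasDerivAt_sqrt ht.ne')
  have h3 := (h.const_mul m).sub ((hasDerivAt_const t r).div h h1.ne')
  have h4 : phs' m r t = m * (1 / (2 * √t)) - (0 * √t - r * (1 / (2 * √t))) / √t ^ 2 := by
    unfold phs'
    generalize √t = u at *
    subst h2
    field_simp
    ring
  rw [h4]
  exact h3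

lemma phs_inj (m r : ℝ) (hm : 0 < m) (hr : 0 < r) : Set.InjOn (phs m r) (Set.Ioi 1) := by
  apply StrictMonoOn.injOn
  intro a ha b hb hab
  simp only [Set.mem_Ioi] at ha hb
  have h0 : 0 < √a := Real.sqrt_pos.2 (by linarith)
  have h1 : √a < √b := Real.sqrt_lt_sqrt (by linarith) hab
  have h2 : r / √b < r / √a := div_lt_div_of_pos_left hr h0 h1
  have h3 : m * √a < m * √b := mul_lt_mul_of_pos_left h1 hm
  unfold phs
  linarith

lemma Kf_eq (n : ℕ) (r t : ℝ) (hr : 1 ≤ r) (ht : 1 ≤ t) :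
    Kf n r t = ((1 + r + t) / t) ^ (((n : ℝ) - 1) / 2) *
      ((1 + r) / ((1 + r + t) * (t * √t))) *
      (exp (-(phs ((n : ℝ) - 1) r t ^ 2 / 4)) * exp (-((n : ℝ) - 1) * r)) := by
  have ht0 : 0 < t := by linarith
  have hs : 0 < 1 + r + t := by linarith
  have e1 : t ^ (-(n : ℝ)/2) = (t ^ (((n : ℝ) - 1) / 2))⁻¹ * (√t)⁻¹ := by
    rw [Real.sqrt_eq_rpow, ← Real.rpow_neg ht0.le, ← Real.rpow_neg ht0.le, ← Real.rpow_add ht0]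
    congr 1; ring
  have e2 : (1 + r + t) ^ (((n : ℝ) - 3)/2) = (1 + r + t) ^ (((n : ℝ) - 1)/2) * (1 + r + t)⁻¹ := by
    rw [← Real.rpow_neg_one, ← Real.rpow_add hs]
    congr 1; ring
  have e3 : -(((n : ℝ) - 1)^2 * t / 4) - r^2 / (4 * t) - ((n : ℝ) - 1) * r / 2
      = -(phs ((n : ℝ) - 1) r t ^ 2 / 4) + -((n : ℝ) - 1) * r := by
    rw [phs_sq _ _ _ ht0]
    field_simp
    ring
  unfold Kf
  rw [e1, e2, e3, Real.exp_add, Real.div_rpow hs.le ht0.le]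
  have := Real.rpow_pos_of_pos ht0 (((n : ℝ) - 1) / 2)
  have : 0 < √t := Real.sqrt_pos.2 ht0
  field_simp

lemma ratio_bound (n : ℕ) (hn : 2 ≤ n) (r t : ℝ) (hr : 1 ≤ r) (ht : 1 ≤ t) :
    ((1 + r + t) / t) ^ (((n : ℝ) - 1) / 2) * exp (-(phs ((n : ℝ) - 1) r t ^ 2 / 8)) ≤
      n.factorial * exp (2 * n + 8) := by
  have ht0 : 0 < t := by linarith
  have hn' : (2 : ℝ) ≤ n := by exact_mod_cast hn
  obtain ⟨x, hx⟩ : ∃ x, x = r / t := ⟨_, rfl⟩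
  have hx0 : 0 < x := by rw [hx]; positivity
  have hrx : r = x * t := by rw [hx]; field_simp
  have a1 : (1 + r + t) / t ≤ 2 + 2 * x := by
    rw [div_le_iff₀ ht0]; nlinarith
  have a0 : 0 < (1 + r + t) / t := by positivity
  have a2 : ((1 + r + t) / t) ^ (((n : ℝ) - 1) / 2) ≤ (2 + 2 * x) ^ n := by
    calc _ ≤ (2 + 2 * x) ^ (((n : ℝ) - 1) / 2) := Real.rpow_le_rpow a0.le a1 (by linarith)
      _ ≤ (2 + 2 * x) ^ (n : ℝ) := Real.rpow_le_rpow_of_exponent_le (by linarith) (by linarith)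
      _ = _ := Real.rpow_natCast _ _
  have a3 : (2 + 2 * x) ^ n ≤ n.factorial * exp (2 + 2 * x) := by
    have := Real.pow_div_factorial_le_exp (2 + 2 * x) (by linarith) n
    rwa [div_le_iff₀' (by positivity)] at this
  have a4 : ((n : ℝ) - 1 - x) ^ 2 ≤ phs ((n : ℝ) - 1) r t ^ 2 := by
    rw [phs_sq _ _ _ ht0, le_div_iff₀ ht0, hrx]
    have : (((n : ℝ) - 1) * t - x * t) ^ 2 = ((n : ℝ) - 1 - x) ^ 2 * t * t := by ring
    rw [this]
    exact le_mul_of_one_le_right (by positivity) ht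
  calc _ ≤ (n.factorial * exp (2 + 2 * x)) * exp (-(phs ((n : ℝ) - 1) r t ^ 2 / 8)) := by
        gcongr; exact a2.trans a3
    _ = n.factorial * exp (2 + 2 * x + -(phs ((n : ℝ) - 1) r t ^ 2 / 8)) := by
        rw [Real.exp_add (2 + 2 * x)]; ring
    _ ≤ _ := by
        refine mul_le_mul_of_nonneg_left (Real.exp_le_exp.2 ?_) (by positivity)
        nlinarith [sq_nonneg (x - ((n : ℝ) - 1) - 8)]

lemma Kf_upper (n : ℕ) (hn : 2 ≤ n) (r t : ℝ) (hr : 1 ≤ r) (ht : 1 ≤ t) :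
    Kf n r t ≤ (4 * (n.factorial * exp (2 * n + 8)) * r⁻¹ * exp (-((n : ℝ) - 1) * r)) *
      (|phs' ((n : ℝ) - 1) r t| * exp (-(1/8) * phs ((n : ℝ) - 1) r t ^ 2)) := by
  have ht0 : 0 < t := by linarith
  have hr0 : 0 < r := by linarith
  have hn' : (2 : ℝ) ≤ n := by exact_mod_cast hn
  have hq : 0 < √t := Real.sqrt_pos.2 ht0
  have hm : 0 < (n : ℝ) - 1 := by linarith
  have hp : 0 ≤ phs' ((n : ℝ) - 1) r t := by unfold phs'; positivity
  have h1 : (1 + r) / ((1 + r + t) * (t * √t)) ≤ 4 * r⁻¹ * phs' ((n : ℝ) - 1) r t := by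
    have : (t + r) / (2 * (t * √t)) ≤ phs' ((n : ℝ) - 1) r t := by
      unfold phs'; gcongr; nlinarith
    refine le_trans ?_ (mul_le_mul_of_nonneg_left this (by positivity))
    have e : 4 * r⁻¹ * ((t + r) / (2 * (t * √t))) = (2 * (t + r) / r) / (t * √t) := by
      field_simp; ring
    rw [e, ← div_div]
    gcongr <;> linarith
  have e : exp (-(phs ((n : ℝ) - 1) r t ^ 2 / 4)) =
      exp (-(phs ((n : ℝ) - 1) r t ^ 2 / 8)) * exp (-(1/8) * phs ((n : ℝ) - 1) r t ^ 2) := by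
    rw [← Real.exp_add]; congr 1; ring
  rw [Kf_eq n r t hr ht, e, abs_of_nonneg hp]
  have hb := ratio_bound n hn r t hr ht
  have h2 := mul_le_mul hb h1 (by positivity) (by positivity)
  have h3 := mul_le_mul_of_nonneg_right h2 (show 0 ≤ exp (-(1/8) * phs ((n : ℝ) - 1) r t ^ 2) *
    exp (-((n : ℝ) - 1) * r) by positivity)
  calc _ = _ := ?_
    _ ≤ _ := h3
    _ = _ := ?_
  · ring
  · ring

lemma Kf_nonneg (n : ℕ) (r t : ℝ) (hr : 1 ≤ r) (ht : 1 ≤ t) : 0 ≤ Kf n r t := by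
  unfold Kf; positivity

lemma Kf_lower (n : ℕ) (hn : 2 ≤ n) (r t : ℝ) (hr : 1 ≤ r)
    (h1 : r / ((n : ℝ) - 1) + 1 ≤ t) (h2 : t ≤ r / ((n : ℝ) - 1) + 1 + √r) :
    (1 / 40 * exp (-((n : ℝ) - 1) ^ 3)) * (r * √r)⁻¹ * exp (-((n : ℝ) - 1) * r) ≤ Kf n r t := by
  have hr0 : 0 < r := by linarith
  have hn' : (2 : ℝ) ≤ n := by exact_mod_cast hn
  obtain ⟨m, hm⟩ : ∃ m, m = (n : ℝ) - 1 := ⟨_, rfl⟩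
  have hm1 : 1 ≤ m := by linarith
  have hd : 0 < r / m := by positivity
  have hd1 : r / m ≤ r := div_le_self hr0.le hm1
  have hmd : m * (r / m) = r := by field_simp
  have hq1 : 1 ≤ √r := Real.one_le_sqrt.2 hr
  have hqq : √r * √r = r := Real.mul_self_sqrt hr0.le
  have hqr : √r ≤ r := by nlinarith
  rw [← hm] at h1 h2
  have ht : 1 ≤ t := by linarith
  have ht0 : 0 < t := by linarith
  have ht4 : t ≤ 3 * r := by linarith
  have hst : √t ≤ 2 * √r := by
    rw [Real.sqrt_le_left (by positivity)]; nlinarith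
  have hst0 : 0 < √t := Real.sqrt_pos.2 ht0
  rw [Kf_eq n r t hr ht, ← hm]
  have b1 : 1 ≤ ((1 + r + t) / t) ^ (m / 2) := by
    apply Real.one_le_rpow _ (by positivity)
    rw [le_div_iff₀ ht0]; linarith
  have b2 : 1 / 40 * (r * √r)⁻¹ ≤ (1 + r) / ((1 + r + t) * (t * √t)) := by
    calc 1 / 40 * (r * √r)⁻¹ ≤ r / ((5 * r) * ((3 * r) * (2 * √r))) := by
          rw [← one_div, div_mul_div_comm, div_le_div_iff₀ (by positivity) (by positivity)]
          have : 0 < r * r * √r := by positivity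
          nlinarith
      _ ≤ _ := by gcongr <;> linarith
  have b3 : exp (- m ^ 3) ≤ exp (-(phs m r t ^ 2 / 4)) := by
    gcongr
    rw [phs_sq _ _ _ ht0]
    have c1 : 0 ≤ m * t - r := by nlinarith
    have c2 : m * t - r ≤ 2 * m * √r := by nlinarith
    have c3 : (m * t - r) ^ 2 ≤ 4 * m ^ 2 * r := by
      calc _ ≤ (2 * m * √r) ^ 2 := by gcongr
        _ = 4 * m ^ 2 * (√r * √r) := by ring
        _ = _ := by rw [hqq]
    rw [div_div, div_le_iff₀ (by positivity)]
    have c4 : r ≤ m * t := by linarith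
    nlinarith [mul_le_mul_of_nonneg_left c4 (show 0 ≤ 4 * m ^ 2 by positivity)]
  calc _ = 1 * (1 / 40 * (r * √r)⁻¹) * (exp (- m ^ 3) * exp (-m * r)) := by ring
    _ ≤ _ := by gcongr
  
lemma gauss_facts (m r : ℝ) (hm : 0 < m) (hr : 0 < r) :
    IntegrableOn (fun t => |phs' m r t| * exp (-(1/8) * phs m r t ^ 2)) (Set.Ioi 1) ∧
    ∫ t in Set.Ioi (1:ℝ), |phs' m r t| * exp (-(1/8) * phs m r t ^ 2) ≤
      ∫ x : ℝ, exp (-(1/8) * x ^ 2) := by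
  have hd : ∀ t ∈ Set.Ioi (1:ℝ), HasDerivWithinAt (phs m r) (phs' m r t) (Set.Ioi 1) t :=
    fun t ht => (phs_deriv m r t (lt_trans one_pos ht)).hasDerivWithinAt
  have hi := phs_inj m r hm hr
  have hg : Integrable (fun x : ℝ => exp (-(1/8) * x ^ 2)) :=
    integrable_exp_neg_mul_sq (by norm_num)
  constructor
  · have := (integrableOn_image_iff_integrableOn_abs_deriv_smul measurableSet_Ioi hd hi
      (fun x : ℝ => exp (-(1/8) * x ^ 2))).1 hg.integrableOn
    simpa [smul_eq_mul] using this
  · have := integral_image_eq_integral_abs_deriv_smul measurableSet_Ioi hd hi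
      (fun x : ℝ => exp (-(1/8) * x ^ 2))
    simp only [smul_eq_mul] at this
    rw [← this]
    exact setIntegral_le_integral hg (Filter.Eventually.of_forall fun x => (exp_pos _).le)

lemma Kf_integrable (n : ℕ) (hn : 2 ≤ n) (r : ℝ) (hr : 1 ≤ r) :
    IntegrableOn (Kf n r) (Set.Ioi 1) := by
  have hn' : (2 : ℝ) ≤ n := by exact_mod_cast hn
  have hg := (gauss_facts ((n:ℝ) - 1) r (by linarith) (by linarith)).1.const_mul
    (4 * (n.factorial * exp (2 * n + 8)) * r⁻¹ * exp (-((n : ℝ) - 1) * r))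
  refine Integrable.mono' hg ?_ ?_
  · apply Measurable.aestronglyMeasurable
    unfold Kf
    fun_prop
  · refine (ae_restrict_iff' measurableSet_Ioi).2 (Filter.Eventually.of_forall fun t ht => ?_)
    have ht : 1 ≤ t := le_of_lt ht
    rw [Real.norm_of_nonneg (Kf_nonneg n r t hr ht)]
    exact Kf_upper n hn r t hr ht

lemma K_upper (n : ℕ) (hn : 2 ≤ n) (r : ℝ) (hr : 1 ≤ r) :
    ∫ t in Set.Ioi (1:ℝ), Kf n r t ≤ (4 * (n.factorial * exp (2 * n + 8)) *
      ∫ x : ℝ, exp (-(1/8) * x ^ 2)) * r⁻¹ * exp (-((n : ℝ) - 1) * r) := by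
  have hn' : (2 : ℝ) ≤ n := by exact_mod_cast hn
  have hr0 : 0 < r := by linarith
  obtain ⟨hg, hle⟩ := gauss_facts ((n:ℝ) - 1) r (by linarith) (by linarith)
  have h1 := setIntegral_mono_on (Kf_integrable n hn r hr) (hg.const_mul
    (4 * (n.factorial * exp (2 * n + 8)) * r⁻¹ * exp (-((n : ℝ) - 1) * r))) measurableSet_Ioi
    (fun t ht => Kf_upper n hn r t hr (le_of_lt ht))
  rw [integral_const_mul] at h1
  refine h1.trans ?_
  refine (mul_le_mul_of_nonneg_left hle (by positivity)).trans (le_of_eq ?_)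
  ring

lemma K_lower (n : ℕ) (hn : 2 ≤ n) (r : ℝ) (hr : 1 ≤ r) :
    (1 / 40 * exp (-((n : ℝ) - 1) ^ 3)) * r⁻¹ * exp (-((n : ℝ) - 1) * r) ≤
      ∫ t in Set.Ioi (1:ℝ), Kf n r t := by
  have hn' : (2 : ℝ) ≤ n := by exact_mod_cast hn
  have hr0 : 0 < r := by linarith
  have hm : 0 < (n : ℝ) - 1 := by linarith
  have hq : 0 < √r := Real.sqrt_pos.2 hr0
  have hI := Kf_integrable n hn r hr
  obtain ⟨a, ha⟩ : ∃ a, a = r / ((n : ℝ) - 1) + 1 := ⟨_, rfl⟩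
  have ha1 : 1 < a := by rw [ha]; have : 0 < r / ((n : ℝ) - 1) := by positivity
                         linarith
  have hsub : Set.Icc a (a + √r) ⊆ Set.Ioi 1 := fun t ht => lt_of_lt_of_le ha1 ht.1
  have h1 : ∫ t in Set.Icc a (a + √r), Kf n r t ≤ ∫ t in Set.Ioi (1:ℝ), Kf n r t := by
    refine setIntegral_mono_set hI ?_ (Filter.Eventually.of_forall hsub)
    exact (ae_restrict_iff' measurableSet_Ioi).2
      (Filter.Eventually.of_forall fun t ht => Kf_nonneg n r t hr (le_of_lt ht))
  have h2 := setIntegral_mono_on (μ := volume) (s := Set.Icc a (a + √r))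
    (f := fun _ => (1 / 40 * exp (-((n : ℝ) - 1) ^ 3)) * (r * √r)⁻¹ * exp (-((n : ℝ) - 1) * r))
    (g := Kf n r) (integrableOn_const (by simp)) (hI.mono_set hsub) measurableSet_Icc
    (fun t ht => Kf_lower n hn r t hr (ha ▸ ht.1) (ha ▸ ht.2))
  refine le_trans (le_of_eq ?_) (h2.trans h1)
  rw [setIntegral_const, Measure.real, Real.volume_Icc, add_sub_cancel_left,
    ENNReal.toReal_ofReal hq.le, smul_eq_mul]
  field_simp



/-- Large-`r` asymptotics of the long-time logarithmic kernel `K₂(r) = ∫₁^∞ P_n(r,t)/t dt`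
built from the Davies–Mandouvalos comparison function: there is `C > 0` with
`C⁻¹ r⁻¹ e^{−(n−1)r} ≤ K₂(r) ≤ C r⁻¹ e^{−(n−1)r}` for all `r ≥ 1`. -/
theorem log_kernel_K2_asymp_large (n : ℕ) (hn : 2 ≤ n) :
    ∃ C : ℝ, 0 < C ∧ ∀ r : ℝ, 1 ≤ r →
      (C⁻¹ * r⁻¹ * Real.exp (-((n : ℝ) - 1) * r) ≤
        ∫ t in Set.Ioi (1 : ℝ),
          (t ^ (-(n : ℝ)/2) *
            Real.exp (-(((n : ℝ) - 1)^2 * t / 4) - r^2 / (4 * t) - ((n : ℝ) - 1) * r / 2) *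
            (1 + r + t) ^ (((n : ℝ) - 3)/2) * (1 + r)) / t) ∧
      ((∫ t in Set.Ioi (1 : ℝ),
          (t ^ (-(n : ℝ)/2) *
            Real.exp (-(((n : ℝ) - 1)^2 * t / 4) - r^2 / (4 * t) - ((n : ℝ) - 1) * r / 2) *
            (1 + r + t) ^ (((n : ℝ) - 3)/2) * (1 + r)) / t) ≤
        C * r⁻¹ * Real.exp (-((n : ℝ) - 1) * r)) := by
  have hn' : (2 : ℝ) ≤ n := by exact_mod_cast hn
  have hA : 0 ≤ 4 * (n.factorial * exp (2 * n + 8)) * ∫ x : ℝ, exp (-(1/8) * x ^ 2) := by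
    have : 0 ≤ ∫ x : ℝ, exp (-(1/8) * x ^ 2) := integral_nonneg fun x => (exp_pos _).le
    positivity
  have hB : 0 < 1 / 40 * exp (-((n : ℝ) - 1) ^ 3) := by positivity
  have hU := K_upper n hn
  have hL := K_lower n hn
  generalize (4 * (n.factorial * exp (2 * n + 8)) * ∫ x : ℝ, exp (-(1/8) * x ^ 2)) = A at *
  generalize 1 / 40 * exp (-((n : ℝ) - 1) ^ 3) = B at *
  have hB' : 0 < B⁻¹ := inv_pos.2 hB
  refine ⟨A + B⁻¹, by linarith, fun r hr => ⟨?_, ?_⟩⟩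
  · have hr0 : 0 < r := by linarith
    refine le_trans ?_ (hL r hr)
    have : (A + B⁻¹)⁻¹ ≤ B := inv_le_of_inv_le₀ hB (by linarith)
    gcongr
  · have hr0 : 0 < r := by linarith
    refine le_trans (hU r hr) ?_
    gcongr
    linarith
end
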